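/- Let M be the local covariance map on 𝕊² defined by M(X) = A X Aᵀ + η²λ² X_{11} Q, where A = [[1−ηλ, −β],[ηλ, β]], Q = [[1,−1],[−1,1]], ηλ > 0, and β ∈ [0,1). If ηλ < 1 − β², then Id − M is invertible, its inverse (Id − M)⁻¹ maps positive semidefinite matrices to positive semidefinite matrices, and the matrix Y := (Id − M)⁻¹(Q) is positive semidefinite with (1,1)-entry Y_{11} = (1+β) / (2ηλ(1−β²−ηλ)). -/

import Mathlib

open Matrix

noncomputable instance : NormedAddCommGroup (Matrix (Fin 2) (Fin 2) ℝ) :=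
  inferInstanceAs (NormedAddCommGroup (Fin 2 → Fin 2 → ℝ))

noncomputable instance : NormedSpace ℝ (Matrix (Fin 2) (Fin 2) ℝ) :=
  inferInstanceAs (NormedSpace ℝ (Fin 2 → Fin 2 → ℝ))

/-- The space `𝕊²` of 2×2 real symmetric matrices, as a submodule of the 2×2 matrices. -/
def Sym2Mat : Submodule ℝ (Matrix (Fin 2) (Fin 2) ℝ) where
  carrier := {X | X.IsSymm}
  add_mem' := fun hA hB => hA.add hB
  zero_mem' := Matrix.isSymm_zero
  smul_mem' := fun c _ hX => hX.smul c

/-- The matrix `A = [[1−ηλ, −β],[ηλ, β]]`. -/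
def Amat (η β l : ℝ) : Matrix (Fin 2) (Fin 2) ℝ := !![1 - η * l, -β; η * l, β]

/-- The matrix `Q = [[1,−1],[−1,1]]`. -/
def Qmat : Matrix (Fin 2) (Fin 2) ℝ := !![1, -1; -1, 1]

theorem Qmat_isSymm : Qmat.IsSymm := by
  ext i j
  fin_cases i <;> fin_cases j <;> simp [Qmat, Matrix.IsSymm]

/-- `Q` as an element of `𝕊²`. -/
def QSym : Sym2Mat := ⟨Qmat, Qmat_isSymm⟩

/-- The solution operator of the Stein equation `X - A X Aᵀ = W`. -/
noncomputable def steinSol (s β : ℝ) (W : Matrix (Fin 2) (Fin 2) ℝ) : Matrix (Fin 2) (Fin 2) ℝ :=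
  (1 / (2 * (1 - β) * (2 + 2 * β - s))) •
      (!![1 + β, β; -s, 2 - s] * W * (!![1 + β, β; -s, 2 - s])ᵀ)
    + (1 / (2 * (1 - β) * s)) •
      (!![β - 1, β; -s, -s] * W * (!![β - 1, β; -s, -s])ᵀ)

/-- The (1,1) entry of the solution of `(Id - M) X = W`. -/
noncomputable def uSol (s β : ℝ) (W : Matrix (Fin 2) (Fin 2) ℝ) : ℝ :=
  ((1 + β - s) * ((1 - β) ^ 2 * W 0 0 - 2 * β * (1 - β) * W 0 1 + β ^ 2 * W 1 1)
    + s * (W 0 0 + β ^ 2 * (W 0 0 + 2 * W 0 1 + W 1 1))) / (2 * s * (1 - β ^ 2 - s))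

noncomputable def nSol (s β : ℝ) (W : Matrix (Fin 2) (Fin 2) ℝ) : Matrix (Fin 2) (Fin 2) ℝ :=
  steinSol s β W + (s ^ 2 * uSol s β W) • steinSol s β Qmat

theorem steinSol_psd (s β : ℝ) (hs : 0 < s) (hβ : β < 1) (h2 : 0 < 2 + 2 * β - s)
    (W : Matrix (Fin 2) (Fin 2) ℝ) (hW : W.PosSemidef) : (steinSol s β W).PosSemidef := by
  have hb : 0 < 1 - β := by linarith
  unfold steinSol
  refine PosSemidef.add (PosSemidef.smul ?_ (by positivity)) (PosSemidef.smul ?_ (by positivity))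
  · simpa using hW.mul_mul_conjTranspose_same (!![1 + β, β; -s, 2 - s])
  · simpa using hW.mul_mul_conjTranspose_same (!![β - 1, β; -s, -s])

theorem Qmat_psd : Qmat.PosSemidef := by
  have := Matrix.posSemidef_vecMulVec_self_star (R := ℝ) ![1, -1]
  convert this using 1
  ext i j
  fin_cases i <;> fin_cases j <;> simp [Qmat, vecMulVec]

theorem uSol_nonneg (s β : ℝ) (hs : 0 < s) (hβ0 : 0 ≤ β) (h : s < 1 - β ^ 2)
    (W : Matrix (Fin 2) (Fin 2) ℝ) (hsym : W 1 0 = W 0 1) (hW : W.PosSemidef) :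
    0 ≤ uSol s β W := by
  have h1 := hW.dotProduct_mulVec_nonneg ![1 - β, -β]
  have h2 := hW.dotProduct_mulVec_nonneg ![1, 0]
  have h3 := hW.dotProduct_mulVec_nonneg ![1, 1]
  simp [dotProduct, mulVec, Fin.sum_univ_two, hsym] at h1 h2 h3
  have h4 : 0 < 1 - β ^ 2 - s := by linarith
  have h5 : 0 ≤ 1 + β - s := by nlinarith
  unfold uSol
  refine div_nonneg (add_nonneg (mul_nonneg h5 ?_) (mul_nonneg hs.le (add_nonneg h2
    (mul_nonneg (sq_nonneg β) ?_)))) (by positivity)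
  · linarith
  · linarith

theorem nSol_psd (s β : ℝ) (hs : 0 < s) (hβ0 : 0 ≤ β) (hβ : β < 1) (h : s < 1 - β ^ 2)
    (W : Matrix (Fin 2) (Fin 2) ℝ) (hsym : W 1 0 = W 0 1) (hW : W.PosSemidef) :
    (nSol s β W).PosSemidef := by
  have h2 : 0 < 2 + 2 * β - s := by nlinarith
  have hu := uSol_nonneg s β hs hβ0 h W hsym hW
  exact PosSemidef.add (steinSol_psd s β hs hβ h2 W hW)
    (PosSemidef.smul (steinSol_psd s β hs hβ h2 _ Qmat_psd) (by positivity))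

theorem stein_eq (η l β : ℝ) (hs : 0 < η * l) (hβ : β < 1) (h2 : 0 < 2 + 2 * β - η * l)
    (W : Matrix (Fin 2) (Fin 2) ℝ) (hsym : W 1 0 = W 0 1) :
    steinSol (η * l) β W - Amat η β l * steinSol (η * l) β W * (Amat η β l)ᵀ = W := by
  have hb : 1 - β ≠ 0 := by linarith
  generalize hse : η * l = s at *
  have h2' : 2 * (1 + β) - s ≠ 0 := by linarith
  have hs' := hs.ne'
  ext i j
  fin_cases i <;> fin_cases j <;>
    simp only [steinSol, Amat, hse, mul_apply, Fin.sum_univ_two, transpose_apply, Matrix.add_apply, Matrix.sub_apply, Matrix.smul_apply, smul_eq_mul] <;>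
    simp [hsym] <;> field_simp <;> ring

theorem nSol_00 (s β : ℝ) (hs : 0 < s) (hβ : β < 1) (h2 : 0 < 2 + 2 * β - s)
    (h : s < 1 - β ^ 2)
    (W : Matrix (Fin 2) (Fin 2) ℝ) (hsym : W 1 0 = W 0 1) : nSol s β W 0 0 = uSol s β W := by
  have hb : 1 - β ≠ 0 := by linarith
  have h2' : 2 * (1 + β) - s ≠ 0 := by linarith
  have hs' := hs.ne'
  have h4 : 1 - β ^ 2 - s ≠ 0 := by linarith
  simp only [nSol, uSol, steinSol, Qmat, mul_apply, Fin.sum_univ_two, transpose_apply, Matrix.add_apply, Matrix.sub_apply, Matrix.smul_apply, smul_eq_mul]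
  simp [hsym]
  field_simp
  ring

theorem nSol_eq (η l β : ℝ) (hs : 0 < η * l) (hβ : β < 1) (h2 : 0 < 2 + 2 * β - η * l)
    (h : η * l < 1 - β ^ 2)
    (W : Matrix (Fin 2) (Fin 2) ℝ) (hsym : W 1 0 = W 0 1) :
    nSol (η * l) β W - (Amat η β l * nSol (η * l) β W * (Amat η β l)ᵀ
      + (η ^ 2 * l ^ 2 * nSol (η * l) β W 0 0) • Qmat) = W := by
  rw [nSol_00 _ β hs hβ h2 h W hsym]
  have e1 := stein_eq η l β hs hβ h2 W hsym
  have e2 := stein_eq η l β hs hβ h2 Qmat (by simp [Qmat])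
  unfold nSol
  rw [Matrix.mul_add, Matrix.add_mul, Matrix.mul_smul, Matrix.smul_mul]
  set S := steinSol (η * l) β W
  set T := steinSol (η * l) β Qmat
  set c := uSol (η * l) β W
  rw [← mul_pow]
  have : ((η * l) ^ 2 * c) • Qmat = ((η * l) ^ 2 * c) • T
      - ((η * l) ^ 2 * c) • (Amat η β l * T * (Amat η β l)ᵀ) := by
    rw [← smul_sub, e2]
  rw [this]
  conv_rhs => rw [← e1]
  abel

theorem sym_apply (X : Sym2Mat) :
    (X : Matrix (Fin 2) (Fin 2) ℝ) 1 0 = (X : Matrix (Fin 2) (Fin 2) ℝ) 0 1 :=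
  IsSymm.apply (A := (X : Matrix (Fin 2) (Fin 2) ℝ)) X.2 0 1

theorem steinSol_symm (s β : ℝ) (W : Matrix (Fin 2) (Fin 2) ℝ) (hW : W.IsSymm) :
    (steinSol s β W).IsSymm := by
  unfold Matrix.IsSymm at *
  simp only [steinSol, transpose_add, transpose_smul, transpose_mul, transpose_transpose, hW,
    Matrix.mul_assoc]

theorem nSol_symm (s β : ℝ) (W : Matrix (Fin 2) (Fin 2) ℝ) (hW : W.IsSymm) :
    (nSol s β W).IsSymm :=
  (steinSol_symm s β W hW).add ((steinSol_symm s β _ Qmat_isSymm).smul _)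

theorem steinSol_add (s β : ℝ) (X Y : Matrix (Fin 2) (Fin 2) ℝ) :
    steinSol s β (X + Y) = steinSol s β X + steinSol s β Y := by
  simp only [steinSol, Matrix.mul_add, Matrix.add_mul]
  module

theorem steinSol_smul (s β c : ℝ) (X : Matrix (Fin 2) (Fin 2) ℝ) :
    steinSol s β (c • X) = c • steinSol s β X := by
  simp only [steinSol, Matrix.mul_smul, Matrix.smul_mul]
  module

noncomputable def nLin (s β : ℝ) : Sym2Mat →ₗ[ℝ] Sym2Mat where
  toFun X := ⟨nSol s β X, nSol_symm s β X X.2⟩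
  map_add' X Y := by
    apply Subtype.ext
    have h1 := steinSol_add s β X Y
    have h2 : uSol s β ((X : Matrix (Fin 2) (Fin 2) ℝ) + Y) = uSol s β X + uSol s β Y := by
      simp only [uSol, Matrix.add_apply]
      ring
    simp only [Submodule.coe_add, nSol, h1, h2]
    module
  map_smul' c X := by
    apply Subtype.ext
    have h1 := steinSol_smul s β c X
    have h2 : uSol s β (c • (X : Matrix (Fin 2) (Fin 2) ℝ)) = c * uSol s β X := by
      simp only [uSol, Matrix.smul_apply, smul_eq_mul]
      ring
    simp only [Submodule.coe_smul, nSol, h1, h2, RingHom.id_apply]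
    module

/-- **Inverse of `Id − M` for the local covariance map.**  Let `M` be the local covariance
map on `𝕊²`, `M(X) = A X Aᵀ + η²λ² X₁₁ Q`.  If `ηλ < 1 − β²`, then `Id − M` is invertible,
its inverse maps positive semidefinite matrices to positive semidefinite matrices, and
`Y := (Id − M)⁻¹(Q)` is positive semidefinite with `Y₁₁ = (1+β)/(2ηλ(1−β²−ηλ))`. -/
theorem local_cov_map_inverse (η l β : ℝ) (hη : 0 < η) (hl : 0 < l)
    (hβ : β ∈ Set.Ico (0 : ℝ) 1)
    (M : Sym2Mat →L[ℝ] Sym2Mat)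
    (hM : ∀ X : Sym2Mat, ((M X : Matrix (Fin 2) (Fin 2) ℝ))
        = Amat η β l * (X : Matrix (Fin 2) (Fin 2) ℝ) * (Amat η β l)ᵀ
          + (η ^ 2 * l ^ 2 * (X : Matrix (Fin 2) (Fin 2) ℝ) 0 0) • Qmat)
    (h : η * l < 1 - β ^ 2) :
    ∃ N : Sym2Mat →L[ℝ] Sym2Mat,
      N * (1 - M) = 1 ∧ (1 - M) * N = 1 ∧
      (∀ X : Sym2Mat, ((X : Matrix (Fin 2) (Fin 2) ℝ)).PosSemidef →
        ((N X : Matrix (Fin 2) (Fin 2) ℝ)).PosSemidef) ∧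
      ((N QSym : Matrix (Fin 2) (Fin 2) ℝ)).PosSemidef ∧
      (N QSym : Matrix (Fin 2) (Fin 2) ℝ) 0 0
        = (1 + β) / (2 * η * l * (1 - β ^ 2 - η * l)) := by
  obtain ⟨hβ0, hβ1⟩ := hβ
  have hs : 0 < η * l := mul_pos hη hl
  have h2 : 0 < 2 + 2 * β - η * l := by nlinarith
  have hright : ∀ X : Sym2Mat, nLin (η * l) β X - M (nLin (η * l) β X) = X := by
    intro X
    apply Subtype.ext
    rw [Submodule.coe_sub, hM]
    exact nSol_eq η l β hs hβ1 h2 h X (sym_apply X)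
  have hmul : ((1 : Sym2Mat →ₗ[ℝ] Sym2Mat) - (M : Sym2Mat →ₗ[ℝ] Sym2Mat)) * nLin (η * l) β = 1 :=
    LinearMap.ext hright
  have hmul' := mul_eq_one_comm.mp hmul
  refine ⟨⟨nLin (η * l) β, LinearMap.continuous_of_finiteDimensional _⟩, ?_, ?_, ?_, ?_, ?_⟩
  · ext1 X
    exact LinearMap.congr_fun hmul' X
  · ext1 X
    exact hright X
  · intro X hX
    exact nSol_psd _ β hs hβ0 hβ1 h X (sym_apply X) hX
  · exact nSol_psd _ β hs hβ0 hβ1 h Qmat (by simp [Qmat]) Qmat_psd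
  · change nSol (η * l) β Qmat 0 0 = _
    rw [nSol_00 _ β hs hβ1 h2 h Qmat (by simp [Qmat])]
    simp only [uSol, Qmat]
    simp
    rw [← mul_assoc 2 η l]
    congr 1
    ring
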